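/- arXiv:2104.04255 — 2 statements merged into one kernel-verified Lean document; each statement's English description precedes it below -/
import Mathlib

section
/- Let K ≥ 2, n ≥ 1, let Â₁,…,Â_K be real n×n matrices and γ > 0, and define the crispmax-reparametrized matrices A₁,…,A_K entrywise by A_k[i,j] = exp(γ·Â_k[i,j]) / (∑_{r=1}^{K} exp(γ·Â_r[i,j])). Let 0 < ε < 1/2. Suppose there exists δ > 0 such that for every pair of indices (i,j) there exists a unique index ℓ ∈ {1,…,K} with Â_ℓ[i,j] ≥ Â_{ℓ'}[i,j] + δ for every ℓ' ≠ ℓ. If γ ≥ (1/δ)·ln( K·√(1−2ε) / (1 − √(1−2ε)) + 1 ), then the family {A₁,…,A_K} is ε-orthogonal, i.e., for all k ≠ k' and all entries (i,j), A_k[i,j]·A_{k'}[i,j] ≤ ε. -/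
/-- **ε-orthogonality bound for the crispmax reparametrization (matrix form).**
Let `Â₁,…,Â_K` be real `n×n` matrices, `γ > 0`, and define the crispmax matrices
`A_k[i,j] = exp(γ·Â_k[i,j]) / ∑_r exp(γ·Â_r[i,j])`. If there is a margin `δ > 0` such that
for every entry `(i,j)` there is a unique `ℓ` dominating all other logits by `δ`, and
`γ ≥ (1/δ)·ln(K·√(1−2ε)/(1−√(1−2ε)) + 1)`, then the family `{A_k}` is ε-orthogonal:
`A_k[i,j]·A_{k'}[i,j] ≤ ε` for all `k ≠ k'` and all `(i,j)`. -/
theorem crispmax_eps_orthogonal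
    (K n : ℕ) (hK : 2 ≤ K) (hn : 1 ≤ n)
    (Ahat : Fin K → Matrix (Fin n) (Fin n) ℝ)
    (γ : ℝ) (hγ : 0 < γ)
    (A : Fin K → Matrix (Fin n) (Fin n) ℝ)
    (hA : ∀ k i j, A k i j =
      Real.exp (γ * Ahat k i j) / ∑ r : Fin K, Real.exp (γ * Ahat r i j))
    (ε : ℝ) (hε0 : 0 < ε) (hε : ε < 1 / 2)
    (δ : ℝ) (hδ : 0 < δ)
    (hsep : ∀ i j : Fin n, ∃! ℓ : Fin K,
      ∀ ℓ' : Fin K, ℓ' ≠ ℓ → Ahat ℓ' i j + δ ≤ Ahat ℓ i j)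
    (hγbound : γ ≥ (1 / δ) *
      Real.log ((K : ℝ) * Real.sqrt (1 - 2 * ε) / (1 - Real.sqrt (1 - 2 * ε)) + 1)) :
    ∀ k k' : Fin K, k ≠ k' → ∀ i j : Fin n, A k i j * A k' i j ≤ ε := by
  intro k k' hkk i j
  obtain ⟨l, hl, -⟩ := hsep i j
  have hs2 : Real.sqrt (1 - 2 * ε) ^ 2 = 1 - 2 * ε := Real.sq_sqrt (by linarith)
  have hs0 : 0 ≤ Real.sqrt (1 - 2 * ε) := Real.sqrt_nonneg _
  have hs1 : Real.sqrt (1 - 2 * ε) < 1 := by nlinarith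
  generalize Real.sqrt (1 - 2 * ε) = s at *
  have h1s : 0 < 1 - s := by linarith
  have hM : (K : ℝ) * s / (1 - s) + 1 ≤ Real.exp (γ * δ) := by
    have hp : 0 < (K : ℝ) * s / (1 - s) + 1 := by positivity
    rw [← Real.log_le_iff_le_exp hp]
    have h := mul_le_mul_of_nonneg_right hγbound hδ.le
    have e : ∀ z : ℝ, 1 / δ * z * δ = z := fun z => by field_simp
    rwa [e] at h
  have hM' : (K : ℝ) * s ≤ (Real.exp (γ * δ) - 1) * (1 - s) := by
    rw [← div_le_iff₀ h1s]; linarith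
  have hMpos := Real.exp_pos (γ * δ)
  have hx : ∀ r, 0 < Real.exp (γ * Ahat r i j) := fun r => Real.exp_pos _
  have hdom : ∀ r, r ≠ l → Real.exp (γ * Ahat r i j) * Real.exp (γ * δ)
      ≤ Real.exp (γ * Ahat l i j) := by
    intro r hr
    rw [← Real.exp_add, Real.exp_le_exp, ← mul_add]
    exact mul_le_mul_of_nonneg_left (hl r hr) hγ.le
  rw [hA, hA]
  generalize Real.exp (γ * δ) = M at *
  generalize hxd : (fun r => Real.exp (γ * Ahat r i j)) = x
  have hxe : ∀ r, Real.exp (γ * Ahat r i j) = x r := fun r => congrFun hxd r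
  simp only [hxe] at *
  have hsum : (∑ r, x r) * M ≤ (K + M - 1) * x l := by
    calc (∑ r, x r) * M = ∑ r, x r * M := Finset.sum_mul _ _ _
      _ ≤ ∑ r, (x l + if r = l then (M - 1) * x l else 0) := by
        apply Finset.sum_le_sum
        intro r _
        split_ifs with h
        · subst h; linarith
        · linarith [hdom r h]
      _ = (K + M - 1) * x l := by
        rw [Finset.sum_add_distrib]; simp; ring
  have hsub : ∀ t : Finset (Fin K), ∑ r ∈ t, x r ≤ ∑ r, x r := fun t =>
    Finset.sum_le_sum_of_subset_of_nonneg (Finset.subset_univ t) (fun r _ _ => (hx r).le)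
  have hSpos : 0 < ∑ r, x r := lt_of_lt_of_le (hx l) (by simpa using hsub {l})
  have hpair : k = l ∨ k' = l ∨ x l + (x k + x k') ≤ ∑ r, x r := by
    by_cases h1 : k = l
    · exact Or.inl h1
    by_cases h2 : k' = l
    · exact Or.inr (Or.inl h2)
    refine Or.inr (Or.inr ?_)
    have := hsub {l, k, k'}
    rwa [Finset.sum_insert (by simp [Ne.symm h1, Ne.symm h2]), Finset.sum_pair hkk] at this
  have hkk2 : x k + x k' ≤ ∑ r, x r := by
    have := hsub {k, k'}
    rwa [Finset.sum_pair hkk] at this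
  generalize ∑ r, x r = S at *
  have hsS : s * S ≤ x l := by
    have h1 : s * (S * M) ≤ s * ((K + M - 1) * x l) := mul_le_mul_of_nonneg_left hsum hs0
    have h2 : (s * (K + M - 1)) * x l ≤ M * x l :=
      mul_le_mul_of_nonneg_right (by nlinarith) (hx l).le
    have h3 : (s * S) * M ≤ x l * M := by linarith
    exact le_of_mul_le_mul_right h3 hMpos
  have hsq : (1 - 2 * ε) * S ^ 2 ≤ x l ^ 2 := by
    rw [← hs2, ← mul_pow]
    exact pow_le_pow_left₀ (by positivity) hsS 2
  have ha := hx k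
  have hb := hx k'
  have hc := hx l
  have key : x l ^ 2 + 2 * (x k * x k') ≤ S ^ 2 := by
    have hq : (x k + x k') ^ 2 ≤ S ^ 2 := pow_le_pow_left₀ (by positivity) hkk2 2
    rcases hpair with h | h | h
    · rw [← h]; nlinarith
    · rw [← h]; nlinarith
    · have hq3 : (x l + (x k + x k')) ^ 2 ≤ S ^ 2 := pow_le_pow_left₀ (by positivity) h 2
      nlinarith [mul_pos hc ha, mul_pos hc hb]
  rw [div_mul_div_comm, div_le_iff₀ (by positivity)]
  nlinarith
end

section
/- Let K ≥ 2, γ > 0, and let a₁,…,a_K be real numbers with softmax values p_k = exp(γ·a_k) / ∑_{r=1}^{K} exp(γ·a_r). Suppose there exist indices ℓ ≠ ℓ' and δ > 0 such that a_ℓ ≥ a_{ℓ'} + δ and a_r ≤ a_{ℓ'} for all r ∉ {ℓ, ℓ'}. If 0 < ε < 1/2 and γ ≥ (1/δ)·ln( K·√(1−2ε) / (1 − √(1−2ε)) + 1 ), then for all k ≠ k' one has p_k · p_{k'} ≤ ε. -/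
/-- **Scalar form of the ε-orthogonality bound.** For softmax values
`p_k = exp(γ·a_k) / ∑_r exp(γ·a_r)`, if `a_ℓ ≥ a_{ℓ'} + δ`, all other logits are at most
`a_{ℓ'}`, and `γ ≥ (1/δ)·ln(K·√(1−2ε)/(1−√(1−2ε)) + 1)` with `0 < ε < 1/2`, then
`p_k·p_{k'} ≤ ε` for all `k ≠ k'`. -/
theorem softmax_eps_orthogonal
    (K : ℕ) (hK : 2 ≤ K) (γ : ℝ) (hγ : 0 < γ)
    (a : Fin K → ℝ)
    (p : Fin K → ℝ)
    (hp : ∀ k, p k = Real.exp (γ * a k) / ∑ r : Fin K, Real.exp (γ * a r))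
    (ℓ ℓ' : Fin K) (hℓ : ℓ ≠ ℓ')
    (δ : ℝ) (hδ : 0 < δ)
    (hgap : a ℓ' + δ ≤ a ℓ)
    (hrest : ∀ r : Fin K, r ≠ ℓ → r ≠ ℓ' → a r ≤ a ℓ')
    (ε : ℝ) (hε0 : 0 < ε) (hε : ε < 1 / 2)
    (hγbound : γ ≥ (1 / δ) *
      Real.log ((K : ℝ) * Real.sqrt (1 - 2 * ε) / (1 - Real.sqrt (1 - 2 * ε)) + 1)) :
    ∀ k k' : Fin K, k ≠ k' → p k * p k' ≤ ε := by
  set s := Real.sqrt (1 - 2 * ε) with hs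
  have hs2 : s ^ 2 = 1 - 2 * ε := Real.sq_sqrt (by linarith)
  have hs0 : 0 < s := Real.sqrt_pos.mpr (by linarith)
  have hs1 : s < 1 := by nlinarith
  have hKpos : (0 : ℝ) < K := by
    have : 0 < K := by omega
    exact_mod_cast this
  have h1s : 0 < 1 - s := by linarith
  have hSpos : 0 < ∑ r : Fin K, Real.exp (γ * a r) :=
    Finset.sum_pos (fun _ _ => Real.exp_pos _) ⟨ℓ, Finset.mem_univ _⟩
  have hp0 : ∀ k, 0 ≤ p k := fun k => by
    rw [hp]; exact div_nonneg (Real.exp_pos _).le hSpos.le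
  have hsum : ∑ k, p k = 1 := by
    simp_rw [hp]
    rw [← Finset.sum_div, div_self hSpos.ne']
  have hE : K * s / (1 - s) + 1 ≤ Real.exp (γ * δ) := by
    have hx : 0 < K * s / (1 - s) + 1 := by positivity
    rw [← Real.log_le_iff_le_exp hx]
    have h := mul_le_mul_of_nonneg_right hγbound hδ.le
    have h2 : 1 / δ * Real.log (K * s / (1 - s) + 1) * δ
        = Real.log (K * s / (1 - s) + 1) := by
      field_simp
    linarith
  have hE2 : K * s + (1 - s) ≤ Real.exp (γ * δ) * (1 - s) := by
    have h := mul_le_mul_of_nonneg_right hE h1s.le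
    have h2 : (K * s / (1 - s) + 1) * (1 - s) = K * s + (1 - s) := by
      field_simp
    linarith
  have hr : ∀ r, r ≠ ℓ → p r * Real.exp (γ * δ) ≤ p ℓ := by
    intro r hrl
    have har : a r ≤ a ℓ' := by
      by_cases h : r = ℓ'
      · rw [h]
      · exact hrest r hrl h
    rw [hp, hp, div_mul_eq_mul_div, ← Real.exp_add]
    apply div_le_div_of_nonneg_right _ hSpos.le
    apply Real.exp_le_exp.mpr
    nlinarith
  have hsplit : p ℓ + ∑ r ∈ Finset.univ.erase ℓ, p r = 1 := by
    rw [Finset.add_sum_erase _ _ (Finset.mem_univ ℓ), hsum]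
  have hb : (1 - p ℓ) * Real.exp (γ * δ) ≤ K * p ℓ := by
    have h1 : 1 - p ℓ = ∑ r ∈ Finset.univ.erase ℓ, p r := by linarith
    rw [h1, Finset.sum_mul]
    calc ∑ r ∈ Finset.univ.erase ℓ, p r * Real.exp (γ * δ)
        ≤ ∑ r ∈ Finset.univ.erase ℓ, p ℓ :=
          Finset.sum_le_sum fun r h => hr r (Finset.ne_of_mem_erase h)
      _ ≤ ∑ r : Fin K, p ℓ :=
          Finset.sum_le_sum_of_subset_of_nonneg (Finset.erase_subset _ _)
            fun _ _ _ => hp0 ℓ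
      _ = K * p ℓ := by simp
  have hps : s ≤ p ℓ := by
    by_contra h
    push Not at h
    have h1 : (1 - s) * Real.exp (γ * δ) ≤ (1 - p ℓ) * Real.exp (γ * δ) :=
      mul_le_mul_of_nonneg_right (by linarith) (Real.exp_pos _).le
    have h2 : K * p ℓ ≤ K * s := mul_le_mul_of_nonneg_left h.le hKpos.le
    linarith
  have hle : ∀ r, r ≠ ℓ → p r ≤ 1 - p ℓ := by
    intro r h
    have := Finset.single_le_sum (f := p) (s := Finset.univ.erase ℓ)
      (fun i _ => hp0 i) (Finset.mem_erase.mpr ⟨h, Finset.mem_univ r⟩)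
    linarith
  have hp1 : p ℓ ≤ 1 := by
    have := Finset.sum_nonneg (s := Finset.univ.erase ℓ) (fun i _ => hp0 i)
    linarith
  have hkey : ∀ r, r ≠ ℓ → p ℓ * p r ≤ ε := by
    intro r h
    nlinarith [mul_le_mul_of_nonneg_left (hle r h) (hp0 ℓ), sq_nonneg (1 - p ℓ)]
  intro k k' hkk
  by_cases h : k = ℓ
  · subst h
    exact hkey k' hkk.symm
  by_cases h' : k' = ℓ
  · subst h'
    rw [mul_comm]
    exact hkey k h
  -- both differ from ℓ
  have hpair : p k + p k' ≤ 1 - p ℓ := by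
    have h1 : ∑ r ∈ ({k, k'} : Finset (Fin K)), p r ≤ ∑ r ∈ Finset.univ.erase ℓ, p r := by
      apply Finset.sum_le_sum_of_subset_of_nonneg
      · intro x hx
        simp only [Finset.mem_insert, Finset.mem_singleton] at hx
        rcases hx with rfl | rfl <;> simp [h, h']
      · exact fun _ _ _ => hp0 _
    rw [Finset.sum_pair hkk] at h1
    linarith
  have h4 : (p k + p k') ^ 2 ≤ (1 - p ℓ) ^ 2 :=
    pow_le_pow_left₀ (add_nonneg (hp0 k) (hp0 k')) hpair 2
  nlinarith [sq_nonneg (p k - p k'), sq_nonneg (p k), sq_nonneg (p k')]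
end
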